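/- (Intermediate TV chain in the proof of Corollary 1.) Let d ≥ 1, let (𝒜, Σ) be a measurable space, and let p be a Markov kernel from ℝ^d to 𝒜. Let γ = N(0, I_d) be the standard Gaussian measure on ℝ^d and M_d = ∫ ‖w‖ dγ(w). Fix contexts c, c' ∈ ℝ^d with Δ = c − c', suppose TV(p(·|c), p(·|c')) ≥ m · ‖Δ‖ for some m > 0, and suppose σ ≥ M_d / m. Then with p_σ the Gaussian context-smoothed kernel p_σ(A|c) = ∫ p(A | c + σ·w) dγ(w), the following chain of inequalities holds: TV(p_σ(·|c), p_σ(·|c')) ≤ (M_d / σ) · ‖Δ‖ ≤ m · ‖Δ‖ ≤ TV(p(·|c), p(·|c')). -/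

import Mathlib

open MeasureTheory Real

/-- The standard Gaussian measure `N(0, I_d)` on `ℝ^d`, given by its density
`(2π)^{-d/2} exp(-‖w‖²/2)` with respect to Lebesgue measure. -/
noncomputable def stdGaussian (d : ℕ) : Measure (EuclideanSpace ℝ (Fin d)) :=
  (volume : Measure (EuclideanSpace ℝ (Fin d))).withDensity
    (fun w => ENNReal.ofReal ((2 * π) ^ (-(d : ℝ) / 2) * Real.exp (-‖w‖ ^ 2 / 2)))

/-- Total variation distance: `TV(P,Q) = sup_{A measurable} |P(A) − Q(A)|`. -/
noncomputable def TV {𝒜 : Type*} [MeasurableSpace 𝒜] (P Q : Measure 𝒜) : ℝ :=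
  ⨆ A : {A : Set 𝒜 // MeasurableSet A}, |(P A.1).toReal - (Q A.1).toReal|

/-- The Gaussian context-smoothed kernel `p_σ(·|c) = ∫ p(· | c + σ·w) dγ(w)`, as a
measure on the action space, for each context `c`. -/
noncomputable def smoothedKernel (d : ℕ) (σ : ℝ) {𝒜 : Type*} [MeasurableSpace 𝒜]
    (p : ProbabilityTheory.Kernel (EuclideanSpace ℝ (Fin d)) 𝒜)
    (c : EuclideanSpace ℝ (Fin d)) : Measure 𝒜 :=
  (stdGaussian d).bind (fun w => p (c + σ • w))

/-- The density of the standard Gaussian measure on `ℝ^d`. -/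
noncomputable def stdGaussianDensity (d : ℕ) (x : EuclideanSpace ℝ (Fin d)) : ℝ :=
  (2 * π) ^ (-(d : ℝ) / 2) * Real.exp (-‖x‖ ^ 2 / 2)

lemma stdGaussianDensity_nonneg (d : ℕ) (x : EuclideanSpace ℝ (Fin d)) :
    0 ≤ stdGaussianDensity d x := by
  unfold stdGaussianDensity
  positivity

lemma continuous_stdGaussianDensity (d : ℕ) : Continuous (stdGaussianDensity d) := by
  unfold stdGaussianDensity
  fun_prop

lemma integrable_exp_neg_mul_sq_norm (d : ℕ) {b : ℝ} (hb : 0 < b) :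
    Integrable (fun x : EuclideanSpace ℝ (Fin d) => Real.exp (-b * ‖x‖ ^ 2)) := by
  have h := GaussianFourier.integrable_cexp_neg_mul_sq_norm_add (b := (b : ℂ))
    (by simpa using hb) 0 (0 : EuclideanSpace ℝ (Fin d))
  refine h.re.congr (Filter.Eventually.of_forall fun x => ?_)
  simp only [inner_zero_left, Complex.ofReal_zero, mul_zero, add_zero]
  rw [← Complex.ofReal_pow, ← Complex.ofReal_neg, ← Complex.ofReal_mul, ← Complex.ofReal_exp]
  exact Complex.ofReal_re _

lemma integrable_stdGaussianDensity (d : ℕ) : Integrable (stdGaussianDensity d) := by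
  refine ((integrable_exp_neg_mul_sq_norm d (b := 1 / 2) (by norm_num)).const_mul
    ((2 * π) ^ (-(d : ℝ) / 2))).congr (Filter.Eventually.of_forall fun x => ?_)
  simp only [stdGaussianDensity]
  ring_nf

lemma integrable_norm_mul_stdGaussianDensity (d : ℕ) :
    Integrable (fun x => ‖x‖ * stdGaussianDensity d x) := by
  refine ((integrable_exp_neg_mul_sq_norm d (b := 1 / 4) (by norm_num)).const_mul
    ((2 * π) ^ (-(d : ℝ) / 2))).mono'
    ((continuous_norm.mul (continuous_stdGaussianDensity d)).aestronglyMeasurable)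
    (Filter.Eventually.of_forall fun x => ?_)
  rw [Real.norm_of_nonneg (mul_nonneg (norm_nonneg x) (stdGaussianDensity_nonneg d x)),
    stdGaussianDensity, mul_left_comm]
  have h : ‖x‖ ≤ Real.exp (‖x‖ ^ 2 / 4) := by
    nlinarith [Real.add_one_le_exp (‖x‖ ^ 2 / 4), sq_nonneg (‖x‖ / 2 - 1)]
  gcongr
  calc ‖x‖ * Real.exp (-‖x‖ ^ 2 / 2)
      ≤ Real.exp (‖x‖ ^ 2 / 4) * Real.exp (-‖x‖ ^ 2 / 2) := by gcongr
    _ = Real.exp (-(1 / 4) * ‖x‖ ^ 2) := by rw [← Real.exp_add]; ring_nf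

lemma stdGaussian_eq_withDensity (d : ℕ) :
    stdGaussian d = volume.withDensity (fun x => ENNReal.ofReal (stdGaussianDensity d x)) := rfl

lemma integral_stdGaussian (d : ℕ) (f : EuclideanSpace ℝ (Fin d) → ℝ) :
    ∫ x, f x ∂(stdGaussian d) = ∫ x, f x * stdGaussianDensity d x := by
  rw [stdGaussian_eq_withDensity, integral_withDensity_eq_integral_toReal_smul
    (continuous_stdGaussianDensity d).measurable.ennreal_ofReal
    (Filter.Eventually.of_forall fun _ => ENNReal.ofReal_lt_top)]
  simp only [ENNReal.toReal_ofReal (stdGaussianDensity_nonneg d _), smul_eq_mul, mul_comm]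

instance isFiniteMeasure_stdGaussian (d : ℕ) : IsFiniteMeasure (stdGaussian d) :=
  isFiniteMeasure_withDensity_ofReal (integrable_stdGaussianDensity d).2

lemma hasDerivAt_stdGaussianDensity_line (d : ℕ) (x b : EuclideanSpace ℝ (Fin d)) (t : ℝ) :
    HasDerivAt (fun t : ℝ => stdGaussianDensity d (x + t • b))
      (-inner ℝ (x + t • b) b * stdGaussianDensity d (x + t • b)) t := by
  have hline : HasDerivAt (fun t : ℝ => x + t • b) b t := by
    simpa using ((hasDerivAt_id t).smul_const b).const_add x
  have h := ((hline.norm_sq.neg.div_const 2).exp).const_mul ((2 * π) ^ (-(d : ℝ) / 2))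
  refine h.congr_deriv ?_
  simp only [stdGaussianDensity, Pi.neg_apply]
  ring

lemma enorm_stdGaussianDensity_add_sub_le (d : ℕ) (x b : EuclideanSpace ℝ (Fin d)) :
    ‖stdGaussianDensity d (x + b) - stdGaussianDensity d x‖ₑ ≤
      ∫⁻ t in Set.Ioc (0 : ℝ) 1,
        ‖b‖ₑ * ‖‖x + t • b‖ * stdGaussianDensity d (x + t • b)‖ₑ := by
  have hcont : Continuous fun t : ℝ =>
      -inner ℝ (x + t • b) b * stdGaussianDensity d (x + t • b) := by
    have := continuous_stdGaussianDensity d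
    fun_prop
  have h := intervalIntegral.integral_eq_sub_of_hasDerivAt
    (fun t _ => hasDerivAt_stdGaussianDensity_line d x b t) (hcont.intervalIntegrable 0 1)
  simp only [one_smul, zero_smul, add_zero] at h
  rw [← h, intervalIntegral.integral_of_le zero_le_one]
  refine (enorm_integral_le_lintegral_enorm _).trans (lintegral_mono fun t => ?_)
  rw [enorm_mul, enorm_mul, ← mul_assoc, enorm_neg, enorm_norm]
  gcongr
  rw [← ofReal_norm, ← ofReal_norm, ← ofReal_norm, ← ENNReal.ofReal_mul (norm_nonneg _), mul_comm]
  exact ENNReal.ofReal_le_ofReal (norm_inner_le_norm _ _)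

lemma lintegral_enorm_stdGaussianDensity_add_sub_le (d : ℕ) (b : EuclideanSpace ℝ (Fin d)) :
    ∫⁻ x, ‖stdGaussianDensity d (x + b) - stdGaussianDensity d x‖ₑ ≤
      ‖b‖ₑ * ∫⁻ x, ‖‖x‖ * stdGaussianDensity d x‖ₑ := by
  have hcont := continuous_stdGaussianDensity d
  calc _ ≤ ∫⁻ x, ∫⁻ t in Set.Ioc (0 : ℝ) 1,
        ‖b‖ₑ * ‖‖x + t • b‖ * stdGaussianDensity d (x + t • b)‖ₑ :=
        lintegral_mono fun x => enorm_stdGaussianDensity_add_sub_le d x b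
    _ = ∫⁻ t in Set.Ioc (0 : ℝ) 1, ∫⁻ x,
        ‖b‖ₑ * ‖‖x + t • b‖ * stdGaussianDensity d (x + t • b)‖ₑ := by
        refine lintegral_lintegral_swap (Measurable.aemeasurable ?_)
        refine Measurable.const_mul (Continuous.measurable ?_) _
        fun_prop
    _ = ∫⁻ _ in Set.Ioc (0 : ℝ) 1, ‖b‖ₑ * ∫⁻ x, ‖‖x‖ * stdGaussianDensity d x‖ₑ := by
        refine lintegral_congr fun t => ?_
        rw [lintegral_const_mul' _ _ enorm_ne_top,
          lintegral_add_right_eq_self (fun x => ‖‖x‖ * stdGaussianDensity d x‖ₑ)]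
    _ = _ := by simp

lemma integral_abs_stdGaussianDensity_add_sub_le (d : ℕ) (b : EuclideanSpace ℝ (Fin d)) :
    ∫ x, |stdGaussianDensity d (x + b) - stdGaussianDensity d x| ≤
      ‖b‖ * ∫ x, ‖x‖ * stdGaussianDensity d x := by
  have hint := integrable_norm_mul_stdGaussianDensity d
  have h := lintegral_enorm_stdGaussianDensity_add_sub_le d b
  have hdiff : Integrable fun x => stdGaussianDensity d (x + b) - stdGaussianDensity d x :=
    ((integrable_stdGaussianDensity d).comp_add_right b).sub (integrable_stdGaussianDensity d)
  rw [← ofReal_integral_norm_eq_lintegral_enorm hint,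
    ← ofReal_integral_norm_eq_lintegral_enorm hdiff,
    ← ofReal_norm, ← ENNReal.ofReal_mul (norm_nonneg _),
    ENNReal.ofReal_le_ofReal_iff (by positivity)] at h
  simpa only [Real.norm_eq_abs, abs_mul, abs_norm,
    abs_of_nonneg (stdGaussianDensity_nonneg d _)] using h

lemma toReal_smoothedKernel_apply (d : ℕ) (σ : ℝ) {𝒜 : Type*} [MeasurableSpace 𝒜]
    (p : ProbabilityTheory.Kernel (EuclideanSpace ℝ (Fin d)) 𝒜)
    [ProbabilityTheory.IsMarkovKernel p] (c : EuclideanSpace ℝ (Fin d))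
    {A : Set 𝒜} (hA : MeasurableSet A) :
    (smoothedKernel d σ p c A).toReal =
      ∫ w, (p (c + σ • w)).real A * stdGaussianDensity d w := by
  have hshift : Measurable fun w : EuclideanSpace ℝ (Fin d) => c + σ • w := by fun_prop
  have hp : Measurable fun w => p (c + σ • w) := p.measurable.comp hshift
  have hpA : Measurable fun w => p (c + σ • w) A := (p.measurable_coe hA).comp hshift
  rw [smoothedKernel, Measure.bind_apply hA hp.aemeasurable, ← integral_toReal hpA.aemeasurable
    (Filter.Eventually.of_forall fun _ => measure_lt_top _ _), integral_stdGaussian]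
  rfl

lemma abs_smoothedKernel_sub_le (d : ℕ) {σ : ℝ} (hσ : 0 < σ) {𝒜 : Type*} [MeasurableSpace 𝒜]
    (p : ProbabilityTheory.Kernel (EuclideanSpace ℝ (Fin d)) 𝒜)
    [ProbabilityTheory.IsMarkovKernel p] (c c' : EuclideanSpace ℝ (Fin d))
    {A : Set 𝒜} (hA : MeasurableSet A) :
    |(smoothedKernel d σ p c A).toReal - (smoothedKernel d σ p c' A).toReal| ≤
      (∫ w, ‖w‖ ∂(stdGaussian d)) / σ * ‖c - c'‖ := by
  set b : EuclideanSpace ℝ (Fin d) := σ⁻¹ • (c - c') with hb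
  have hmeas : AEStronglyMeasurable (fun w => (p (c + σ • w)).real A) volume :=
    (((p.measurable_coe hA).comp
      (by fun_prop : Measurable fun w => c + σ • w)).ennreal_toReal).aestronglyMeasurable
  have hbound : ∀ᵐ w, ‖(p (c + σ • w)).real A‖ ≤ 1 :=
    Filter.Eventually.of_forall fun w => by
      rw [Real.norm_of_nonneg measureReal_nonneg]
      exact measureReal_le_one
  have hg := integrable_stdGaussianDensity d
  have hgb := hg.comp_add_right b
  have hshift : ∫ w, (p (c' + σ • w)).real A * stdGaussianDensity d w =
      ∫ w, (p (c + σ • w)).real A * stdGaussianDensity d (w + b) := by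
    rw [← integral_add_right_eq_self (μ := volume)
      (fun w => (p (c' + σ • w)).real A * stdGaussianDensity d w) b]
    congr with w
    have : c' + σ • (w + b) = c + σ • w := by
      rw [hb, smul_add, smul_inv_smul₀ hσ.ne']
      abel
    rw [this]
  rw [toReal_smoothedKernel_apply d σ p c hA, toReal_smoothedKernel_apply d σ p c' hA, hshift,
    abs_sub_comm, ← integral_sub (hgb.bdd_mul hmeas hbound) (hg.bdd_mul hmeas hbound)]
  calc |∫ w, ((p (c + σ • w)).real A * stdGaussianDensity d (w + b) -
          (p (c + σ • w)).real A * stdGaussianDensity d w)|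
      ≤ ∫ w, |stdGaussianDensity d (w + b) - stdGaussianDensity d w| := by
        rw [← Real.norm_eq_abs]
        refine norm_integral_le_of_norm_le (hgb.sub hg).abs
          (Filter.Eventually.of_forall fun w => ?_)
        rw [← mul_sub, norm_mul, Real.norm_of_nonneg measureReal_nonneg]
        exact mul_le_of_le_one_left (abs_nonneg _) measureReal_le_one
    _ ≤ ‖b‖ * ∫ x, ‖x‖ * stdGaussianDensity d x :=
        integral_abs_stdGaussianDensity_add_sub_le d b
    _ = _ := by
        rw [integral_stdGaussian, hb, norm_smul, norm_inv, Real.norm_of_nonneg hσ.le]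
        ring

/-- **Intermediate TV chain in the proof of Corollary 1.** Under the identifiability lower
bound `TV(p(·|c), p(·|c')) ≥ m · ‖Δ‖` with `Δ = c − c'` and `σ ≥ M_d / m`, one has
`TV(p_σ(·|c), p_σ(·|c')) ≤ (M_d/σ)·‖Δ‖ ≤ m·‖Δ‖ ≤ TV(p(·|c), p(·|c'))`. -/
theorem tv_chain_of_corollary
    (d : ℕ) (hd : 1 ≤ d) {𝒜 : Type*} [MeasurableSpace 𝒜]
    (p : ProbabilityTheory.Kernel (EuclideanSpace ℝ (Fin d)) 𝒜)
    [ProbabilityTheory.IsMarkovKernel p]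
    (M : ℝ) (hM : M = ∫ w, ‖w‖ ∂(stdGaussian d))
    (c c' : EuclideanSpace ℝ (Fin d)) (m : ℝ) (hm : 0 < m)
    (h_ident : TV (p c) (p c') ≥ m * ‖c - c'‖)
    (σ : ℝ) (hσ : 0 < σ) (hσ_noisy : σ ≥ M / m) :
    TV (smoothedKernel d σ p c) (smoothedKernel d σ p c') ≤ (M / σ) * ‖c - c'‖ ∧
    (M / σ) * ‖c - c'‖ ≤ m * ‖c - c'‖ ∧
    m * ‖c - c'‖ ≤ TV (p c) (p c') := by
  refine ⟨?_, ?_, h_ident⟩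
  · subst hM
    have : Nonempty {A : Set 𝒜 // MeasurableSet A} := ⟨⟨∅, MeasurableSet.empty⟩⟩
    exact ciSup_le fun A => abs_smoothedKernel_sub_le d hσ p c c' A.2
  · have : M / σ ≤ m := by
      rw [div_le_iff₀ hσ, mul_comm]
      exact (div_le_iff₀ hm).1 hσ_noisy
    gcongr
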